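/- arXiv:2103.16837 — 2 statements merged into one kernel-verified Lean document; each statement's English description precedes it below -/
import Mathlib

section
/- Let P ⊂ ℝⁿ be a polytope (the convex hull of a finite set). Then, as functions on ℝⁿ, Σ_{Q ⪯ P} (−1)^{dim Q} 𝟙_Q = (−1)^{dim P} 𝟙_{relint P}, where the sum runs over all nonempty faces Q of P (including P itself) and relint P denotes the relative interior of P. -/
open Set MeasureTheory
open scoped RealInnerProductSpace BigOperators Classical Pointwise

noncomputable section

/-- Euclidean space `ℝⁿ` with its standard inner product. -/
abbrev Euc (n : ℕ) := EuclideanSpace ℝ (Fin n)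

variable {n : ℕ}
/-- A polytope: the convex hull of a finite set. -/
def IsPolytope (P : Set (Euc n)) : Prop := ∃ S : Finset (Euc n), P = convexHull ℝ ↑S

/-- `Q` is a face of `P`: either `Q = P` or `Q` is the intersection of `P` with a
supporting hyperplane. -/
def IsPolyFace (P Q : Set (Euc n)) : Prop :=
  Q = P ∨ ∃ u : Euc n, u ≠ 0 ∧ ∃ r : ℝ, (∀ y ∈ P, ⟪y, u⟫ ≤ r) ∧ Q = {y ∈ P | ⟪y, u⟫ = r}

/-- The dimension of a polytope/face: the dimension of the direction of its affine span. -/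
def polyDim (Q : Set (Euc n)) : ℕ := Module.finrank ℝ (affineSpan ℝ Q).direction

section RelativelyOpenCones

variable {E : Type*} [NormedAddCommGroup E] [NormedSpace ℝ E]

/-- A convex set that is relatively open in some linear subspace. -/
def IsSubspaceOpenConvex (U : Set E) : Prop :=
  ∃ (O : Set E) (A : Submodule ℝ E), IsOpen O ∧ Convex ℝ O ∧ U = O ∩ A

/-- The compactly supported Euler characteristic of a convex set which is relatively open in
its linear span. -/
def openEuler (U : Set E) : ℝ :=
  if U.Nonempty then (-1) ^ Module.finrank ℝ (Submodule.span ℝ U) else 0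

lemma openEuler_empty : openEuler (∅ : Set E) = 0 := by simp [openEuler]

lemma exists_pos_add_smul_mem {O : Set E} (hO : IsOpen O) {p : E} (hp : p ∈ O) (v : E) :
    ∃ ε : ℝ, 0 < ε ∧ p + ε • v ∈ O ∧ p - ε • v ∈ O := by
  have h1 : ∀ᶠ t : ℝ in nhds 0, p + t • v ∈ O :=
    (by fun_prop : Continuous fun t : ℝ => p + t • v).continuousAt.eventually_mem
      (hO.mem_nhds (by simpa using hp))
  have h2 : ∀ᶠ t : ℝ in nhds 0, p - t • v ∈ O :=
    (by fun_prop : Continuous fun t : ℝ => p - t • v).continuousAt.eventually_mem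
      (hO.mem_nhds (by simpa using hp))
  obtain ⟨ε, hε, h⟩ := Metric.eventually_nhds_iff.1 (h1.and h2)
  refine ⟨ε / 2, half_pos hε, h ?_⟩
  simp [abs_of_pos hε, hε]

lemma span_open_inter {O : Set E} (hO : IsOpen O) (A : Submodule ℝ E)
    (hne : (O ∩ A : Set E).Nonempty) : Submodule.span ℝ (O ∩ A : Set E) = A := by
  apply le_antisymm (Submodule.span_le.2 inter_subset_right)
  intro v hv
  obtain ⟨p, hpO, hpA⟩ := hne
  obtain ⟨ε, hε, h1, -⟩ := exists_pos_add_smul_mem hO hpO v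
  have h2 : ε • v ∈ Submodule.span ℝ (O ∩ A : Set E) := by
    have := Submodule.sub_mem _
      (Submodule.subset_span ⟨h1, A.add_mem hpA (A.smul_mem ε hv)⟩ :
        p + ε • v ∈ Submodule.span ℝ (O ∩ A : Set E))
      (Submodule.subset_span ⟨hpO, hpA⟩)
    simpa using this
  exact (Submodule.smul_mem_iff _ hε.ne').1 h2

lemma openEuler_open_inter {O : Set E} (hO : IsOpen O) (A : Submodule ℝ E) :
    openEuler (O ∩ A : Set E) =
      if (O ∩ A : Set E).Nonempty then (-1) ^ Module.finrank ℝ A else 0 := by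
  unfold openEuler
  split_ifs with h
  · rw [span_open_inter hO A h]
  · rfl

lemma isOpen_linear_pos [FiniteDimensional ℝ E] (h : E →ₗ[ℝ] ℝ) : IsOpen {u | 0 < h u} :=
  isOpen_lt continuous_const h.continuous_of_finiteDimensional

lemma convex_linear_pos (h : E →ₗ[ℝ] ℝ) : Convex ℝ {u | 0 < h u} :=
  convex_halfSpace_gt h.isLinear 0

lemma IsSubspaceOpenConvex.inter {U V : Set E} (hU : IsSubspaceOpenConvex U)
    (hV : IsSubspaceOpenConvex V) : IsSubspaceOpenConvex (U ∩ V) := by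
  obtain ⟨O, A, hO, hc, rfl⟩ := hU
  obtain ⟨O', A', hO', hc', rfl⟩ := hV
  refine ⟨O ∩ O', A ⊓ A', hO.inter hO', hc.inter hc', ?_⟩
  ext; simp; tauto

lemma isSubspaceOpenConvex_submodule (A : Submodule ℝ E) : IsSubspaceOpenConvex (A : Set E) :=
  ⟨univ, A, isOpen_univ, convex_univ, by simp⟩

lemma isSubspaceOpenConvex_pos [FiniteDimensional ℝ E]
    (h : E →ₗ[ℝ] ℝ) : IsSubspaceOpenConvex {u | 0 < h u} :=
  ⟨_, ⊤, isOpen_linear_pos h, convex_linear_pos h, by simp⟩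

lemma isSubspaceOpenConvex_zero (h : E →ₗ[ℝ] ℝ) : IsSubspaceOpenConvex {u | h u = 0} :=
  isSubspaceOpenConvex_submodule (LinearMap.ker h)

lemma isSubspaceOpenConvex_biInter {ι : Type*} (I : Finset ι) {V : ι → Set E}
    (hV : ∀ i ∈ I, IsSubspaceOpenConvex (V i)) :
    IsSubspaceOpenConvex {u | ∀ i ∈ I, u ∈ V i} := by
  induction I using Finset.induction_on with
  | empty => simpa using isSubspaceOpenConvex_submodule (⊤ : Submodule ℝ E)
  | insert k I _ ih =>
    have := (hV k (by simp)).inter (ih fun i hi => hV i (by simp [hi]))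
    convert this using 1
    ext; simp

lemma openEuler_slice [FiniteDimensional ℝ E]
    {U : Set E} (hU : IsSubspaceOpenConvex U) (h : E →ₗ[ℝ] ℝ)
    (hne : (U ∩ {u | h u = 0}).Nonempty) {v : E} (hv : v ∈ Submodule.span ℝ U) (hv0 : h v ≠ 0) :
    openEuler (U ∩ {u | h u = 0}) = -openEuler U := by
  obtain ⟨O, A, hO, -, rfl⟩ := hU
  have hne' : (O ∩ A : Set E).Nonempty := hne.mono inter_subset_left
  rw [span_open_inter hO A hne'] at hv
  have hs : (O ∩ A ∩ {u | h u = 0} : Set E) = O ∩ (A ⊓ LinearMap.ker h : Submodule ℝ E) := by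
    ext; simp [and_assoc]
  rw [hs] at hne ⊢
  rw [openEuler_open_inter hO, openEuler_open_inter hO, if_pos hne, if_pos hne']
  have hr := LinearMap.finrank_range_add_finrank_ker (h.domRestrict A)
  have h1 : LinearMap.range (h.domRestrict A) = ⊤ := by
    apply LinearMap.range_eq_top.2
    intro c
    refine ⟨(c / h v) • ⟨v, hv⟩, ?_⟩
    simp [LinearMap.domRestrict_apply, hv0]
  have h2 : Module.finrank ℝ (LinearMap.ker (h.domRestrict A)) =
      Module.finrank ℝ (A ⊓ LinearMap.ker h : Submodule ℝ E) := by
    rw [LinearMap.ker_domRestrict, ← Submodule.finrank_map_subtype_eq,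
      Submodule.map_comap_subtype]
  rw [h1, finrank_top, Module.finrank_self, h2] at hr
  rw [← hr, pow_add]
  ring

lemma openEuler_split [FiniteDimensional ℝ E]
    {U : Set E} (hU : IsSubspaceOpenConvex U) (h : E →ₗ[ℝ] ℝ) :
    openEuler (U ∩ {u | 0 < h u}) + openEuler (U ∩ {u | h u = 0}) +
      openEuler (U ∩ {u | h u < 0}) = openEuler U := by
  obtain hemp | hUne := U.eq_empty_or_nonempty
  · simp [hemp, openEuler_empty]
  have hU' := hU
  obtain ⟨O, A, hO, hc, rfl⟩ := hU
  by_cases hA : ∀ v ∈ A, h v = 0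
  · have e1 : (O ∩ A ∩ {u | 0 < h u} : Set E) = ∅ := by
      refine eq_empty_of_forall_notMem ?_
      rintro u ⟨⟨-, hu⟩, h0⟩
      simp [hA u hu] at h0
    have e2 : (O ∩ A ∩ {u | h u < 0} : Set E) = ∅ := by
      refine eq_empty_of_forall_notMem ?_
      rintro u ⟨⟨-, hu⟩, h0⟩
      simp [hA u hu] at h0
    have e3 : (O ∩ A ∩ {u | h u = 0} : Set E) = O ∩ A :=
      inter_eq_left.2 fun u hu => hA u hu.2
    rw [e1, e2, e3]
    simp [openEuler_empty]
  push Not at hA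
  obtain ⟨v, hvA, hv⟩ := hA
  have hpos : ∀ g : E →ₗ[ℝ] ℝ, (O ∩ A ∩ {u | 0 < g u} : Set E).Nonempty →
      openEuler (O ∩ A ∩ {u | 0 < g u} : Set E) = openEuler (O ∩ A : Set E) := by
    intro g hg
    have hs : (O ∩ A ∩ {u | 0 < g u} : Set E) = (O ∩ {u | 0 < g u}) ∩ A := inter_right_comm _ _ _
    rw [hs] at hg ⊢
    rw [openEuler_open_inter (hO.inter (isOpen_linear_pos g)), openEuler_open_inter hO,
      if_pos hg, if_pos hUne]
  have hneg : (O ∩ A ∩ {u | h u < 0} : Set E) = O ∩ A ∩ {u | 0 < (-h) u} := by simp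
  rw [hneg]
  by_cases hz : (O ∩ A ∩ {u | h u = 0} : Set E).Nonempty
  · rw [openEuler_slice hU' h hz (by rwa [span_open_inter hO A hUne]) hv]
    obtain ⟨p, ⟨hpO, hpA⟩, hp0⟩ := hz
    obtain ⟨ε, hε, h1, h2⟩ := exists_pos_add_smul_mem hO hpO ((h v) • v)
    have hp0 : h p = 0 := hp0
    have hq : 0 < ε * (h v * h v) := mul_pos hε (mul_self_pos.2 hv)
    rw [hpos h ⟨_, ⟨h1, A.add_mem hpA (A.smul_mem _ (A.smul_mem _ hvA))⟩, by simp [hp0, hq]⟩,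
      hpos (-h) ⟨_, ⟨h2, A.sub_mem hpA (A.smul_mem _ (A.smul_mem _ hvA))⟩, by simp [hp0, hq]⟩]
    ring
  · have hconv : Convex ℝ (O ∩ A : Set E) := hc.inter A.convex
    have hnot : ¬ ((O ∩ A ∩ {u | 0 < h u} : Set E).Nonempty ∧
        (O ∩ A ∩ {u | 0 < (-h) u} : Set E).Nonempty) := by
      rintro ⟨⟨p, hp, hp0⟩, ⟨q, hq, hq0⟩⟩
      simp only [mem_ofPred_eq, LinearMap.neg_apply, Left.neg_pos_iff] at hp0 hq0
      have hd : 0 < h p - h q := by linarith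
      refine hz ⟨(-h q / (h p - h q)) • p + (h p / (h p - h q)) • q,
        hconv hp hq (div_nonneg (by linarith) hd.le) (div_nonneg hp0.le hd.le) ?_, ?_⟩
      · field_simp; ring
      · simp only [mem_ofPred_eq, map_add, map_smul, smul_eq_mul]; ring
    rw [not_nonempty_iff_eq_empty.1 hz, openEuler_empty]
    by_cases hp : (O ∩ A ∩ {u | 0 < h u} : Set E).Nonempty
    · rw [hpos h hp, not_nonempty_iff_eq_empty.1 fun hq => hnot ⟨hp, hq⟩, openEuler_empty]
      ring
    · have hq : (O ∩ A ∩ {u | 0 < (-h) u} : Set E).Nonempty := by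
        obtain ⟨u, hu⟩ := hUne
        refine ⟨u, hu, ?_⟩
        have h1 : ¬ 0 < h u := fun h' => hp ⟨u, hu, h'⟩
        have h2 : ¬ h u = 0 := fun h' => hz ⟨u, hu, h'⟩
        simpa using lt_of_le_of_ne (not_lt.1 h1) h2
      rw [hpos _ hq, not_nonempty_iff_eq_empty.1 hp, openEuler_empty]
      ring

variable {ι : Type*}

/-- The points of `U` at which the subfamily of `f` (over `I`) attaining the minimum is
exactly `J`. -/
def argminCell (f : ι → E →ₗ[ℝ] ℝ) (I J : Finset ι) (U : Set E) : Set E :=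
  {u ∈ U | ∃ j ∈ J, (∀ i ∈ J, f i u = f j u) ∧ ∀ i ∈ I, i ∉ J → f j u < f i u}

lemma argminCell_empty (f : ι → E →ₗ[ℝ] ℝ) (I : Finset ι) (U : Set E) :
    argminCell f I ∅ U = ∅ := by simp [argminCell]

lemma mem_argminCell_iff {f : ι → E →ₗ[ℝ] ℝ} {I J : Finset ι} {U : Set E} {k : ι} (hk : k ∈ J)
    {u : E} : u ∈ argminCell f I J U ↔
      u ∈ U ∧ (∀ i ∈ J, f i u = f k u) ∧ ∀ i ∈ I, i ∉ J → f k u < f i u := by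
  constructor
  · rintro ⟨hu, j, hj, h1, h2⟩
    refine ⟨hu, fun i hi => (h1 i hi).trans (h1 k hk).symm, fun i hi hiJ => ?_⟩
    rw [h1 k hk]
    exact h2 i hi hiJ
  · rintro ⟨hu, h1, h2⟩
    exact ⟨hu, k, hk, h1, h2⟩

lemma isSubspaceOpenConvex_argminCell [FiniteDimensional ℝ E]
    (f : ι → E →ₗ[ℝ] ℝ) (I : Finset ι) {J : Finset ι}
    (hJ : J.Nonempty) {U : Set E} (hU : IsSubspaceOpenConvex U) :
    IsSubspaceOpenConvex (argminCell f I J U) := by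
  obtain ⟨k, hk⟩ := hJ
  have h := hU.inter ((isSubspaceOpenConvex_biInter J
    fun i _ => isSubspaceOpenConvex_zero (f i - f k)).inter
    (isSubspaceOpenConvex_biInter (I \ J) fun i _ => isSubspaceOpenConvex_pos (f i - f k)))
  convert h using 1
  ext u
  rw [mem_argminCell_iff hk]
  simp [sub_eq_zero]

/-- Decomposing a relatively open convex set according to which members of a finite family of
linear functionals attain the minimum preserves the Euler characteristic. -/
lemma sum_openEuler_argminCell [FiniteDimensional ℝ E]
    (f : ι → E →ₗ[ℝ] ℝ) {I : Finset ι} (hI : I.Nonempty) :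
    ∀ {U : Set E}, IsSubspaceOpenConvex U →
      ∑ J ∈ I.powerset, openEuler (argminCell f I J U) = openEuler U := by
  induction hI using Finset.Nonempty.cons_induction with
  | singleton k =>
    intro U _
    rw [← insert_empty_eq, Finset.sum_powerset_insert (by simp)]
    simp only [Finset.powerset_empty, Finset.sum_singleton, argminCell_empty, openEuler_empty,
      zero_add]
    congr 1
    ext u
    simp [argminCell]
  | cons k I hk hI ih =>
    intro U hU
    rw [Finset.cons_eq_insert, Finset.sum_powerset_insert hk, ← Finset.sum_add_distrib]
    set U' : Set E := U ∩ {u | ∀ i ∈ I, 0 < (f i - f k) u} with hU'def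
    have hU' : IsSubspaceOpenConvex U' :=
      hU.inter (isSubspaceOpenConvex_biInter I fun i _ => isSubspaceOpenConvex_pos (f i - f k))
    have key : ∀ J ∈ I.powerset,
        openEuler (argminCell f (insert k I) J U) +
          openEuler (argminCell f (insert k I) (insert k J) U) +
          openEuler (argminCell f I J U') =
        openEuler (argminCell f I J U) + if J = ∅ then openEuler U' else 0 := by
      intro J hJ
      rw [Finset.mem_powerset] at hJ
      have hkJ : k ∉ J := fun h => hk (hJ h)
      obtain rfl | hJne := J.eq_empty_or_nonempty
      · simp only [argminCell_empty, openEuler_empty, if_true, zero_add, add_zero]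
        congr 1
        ext u
        rw [mem_argminCell_iff (Finset.mem_insert_self k ∅)]
        simp only [hU'def, mem_inter_iff, mem_ofPred_eq, LinearMap.sub_apply, sub_pos]
        grind
      · obtain ⟨j, hj⟩ := hJne
        rw [if_neg (Finset.ne_empty_of_mem hj), add_zero,
          ← openEuler_split (isSubspaceOpenConvex_argminCell f I ⟨j, hj⟩ hU) (f k - f j)]
        congr 1
        · congr 1
          · congr 1
            ext u
            simp only [mem_inter_iff, mem_argminCell_iff hj, mem_ofPred_eq, LinearMap.sub_apply,
              sub_pos]
            grind
          · congr 1
            ext u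
            simp only [mem_inter_iff, mem_argminCell_iff hj,
              mem_argminCell_iff (Finset.mem_insert_of_mem hj), mem_ofPred_eq,
              LinearMap.sub_apply, sub_eq_zero]
            grind
        · congr 1
          ext u
          simp only [hU'def, mem_inter_iff, mem_argminCell_iff hj, mem_ofPred_eq,
            LinearMap.sub_apply, sub_pos, sub_neg]
          grind
    have hsum := Finset.sum_congr rfl key
    rw [Finset.sum_add_distrib, ih hU',
      Finset.sum_add_distrib (f := fun J => openEuler (argminCell f I J U)), ih hU,
      Finset.sum_ite_eq' I.powerset ∅] at hsum
    simpa using hsum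

/-- The stratum of the cone `{u | ∀ i ∈ S, 0 ≤ f i u}` on which exactly the functionals
indexed by `J` vanish. -/
def coneStratum (f : ι → E →ₗ[ℝ] ℝ) (S J : Finset ι) : Set E :=
  {u | (∀ i ∈ J, f i u = 0) ∧ ∀ i ∈ S, i ∉ J → 0 < f i u}

lemma sum_openEuler_stratum_of_eq_one [FiniteDimensional ℝ E]
    (f : ι → E →ₗ[ℝ] ℝ) {I : Finset ι} (hI : I.Nonempty)
    (L : Submodule ℝ E) {w : E} (hwL : w ∈ L) (hw : ∀ i ∈ I, f i w = 1) :
    ∑ K ∈ I.powerset, openEuler (L ∩ coneStratum f I K : Set E) = 0 := by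
  have hL := isSubspaceOpenConvex_submodule L
  have key : ∀ K ∈ I.powerset, openEuler (L ∩ coneStratum f I K : Set E) =
      -openEuler (argminCell f I K (L : Set E)) + if K = ∅ then openEuler (L : Set E) else 0 := by
    intro K hK
    rw [Finset.mem_powerset] at hK
    obtain rfl | ⟨k, hk⟩ := K.eq_empty_or_nonempty
    · rw [argminCell_empty, openEuler_empty, if_pos rfl, neg_zero, zero_add]
      have hO : IsOpen {u | ∀ i ∈ I, 0 < f i u} := by
        simp only [ofPred_forall]
        exact isOpen_biInter_finset fun i _ => isOpen_linear_pos (f i)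
      have hs : (L ∩ coneStratum f I ∅ : Set E) = {u | ∀ i ∈ I, 0 < f i u} ∩ L := by
        ext u; simp [coneStratum, and_comm]
      have hs' : (L : Set E) = univ ∩ L := by simp
      rw [hs, openEuler_open_inter hO, if_pos ⟨w, fun i hi => by simp [hw i hi], hwL⟩, hs',
        openEuler_open_inter isOpen_univ, if_pos ⟨w, trivial, hwL⟩]
    · rw [if_neg (Finset.ne_empty_of_mem hk), add_zero]
      have hs : (L ∩ coneStratum f I K : Set E) =
          argminCell f I K (L : Set E) ∩ {u | f k u = 0} := by
        ext u
        simp only [coneStratum, mem_inter_iff, mem_argminCell_iff hk, mem_ofPred_eq]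
        grind
      rw [hs]
      obtain he | ⟨p, hp⟩ := (argminCell f I K (L : Set E)).eq_empty_or_nonempty
      · rw [he, empty_inter, openEuler_empty, neg_zero]
      have hshift : ∀ c : ℝ, p + c • w ∈ argminCell f I K (L : Set E) := by
        intro c
        rw [mem_argminCell_iff hk] at hp ⊢
        obtain ⟨hpL, h1, h2⟩ := hp
        refine ⟨L.add_mem hpL (L.smul_mem c hwL), fun i hi => ?_, fun i hi hiK => ?_⟩
        · simp [hw i (hK hi), hw k (hK hk), h1 i hi]
        · simpa [hw i hi, hw k (hK hk)] using h2 i hi hiK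
      have hwspan : w ∈ Submodule.span ℝ (argminCell f I K (L : Set E)) := by
        simpa using Submodule.sub_mem _ (Submodule.subset_span (hshift 1))
          (Submodule.subset_span hp)
      refine openEuler_slice (isSubspaceOpenConvex_argminCell f I ⟨k, hk⟩ hL) (f k)
        ⟨_, hshift (-f k p), ?_⟩ hwspan (by simp [hw k (hK hk)])
      simp [hw k (hK hk)]
  rw [Finset.sum_congr rfl key, Finset.sum_add_distrib, Finset.sum_neg_distrib,
    sum_openEuler_argminCell f hI hL, Finset.sum_ite_eq' I.powerset ∅]
  simp

/-- The Euler relation for polyhedral cones that are not linear subspaces. -/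
lemma sum_openEuler_coneStratum [FiniteDimensional ℝ E] (f : ι → E →ₗ[ℝ] ℝ) (S : Finset ι) {w : E}
    (hw : ∀ i ∈ S, 0 ≤ f i w) (hpos : ∃ i ∈ S, 0 < f i w) :
    ∑ J ∈ S.powerset, openEuler (coneStratum f S J) = 0 := by
  obtain ⟨w, hw, hpos, hmax⟩ : ∃ w, (∀ i ∈ S, 0 ≤ f i w) ∧ (∃ i ∈ S, 0 < f i w) ∧
      ∀ u, (∀ i ∈ S, 0 ≤ f i u) → ∀ i ∈ S, 0 < f i u → 0 < f i w := by
    have hex : ∀ i, ∃ v, (∀ j ∈ S, 0 ≤ f j v) ∧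
        ∀ u, (∀ j ∈ S, 0 ≤ f j u) → 0 < f i u → 0 < f i v := by
      intro i
      by_cases h : ∃ v, (∀ j ∈ S, 0 ≤ f j v) ∧ 0 < f i v
      · obtain ⟨v, hv, hiv⟩ := h
        exact ⟨v, hv, fun _ _ _ => hiv⟩
      · exact ⟨0, by simp, fun u hu hiu => (h ⟨u, hu, hiu⟩).elim⟩
    choose v hv hvmax using hex
    have hmax : ∀ u, (∀ i ∈ S, 0 ≤ f i u) → ∀ i ∈ S, 0 < f i u → 0 < f i (∑ j ∈ S, v j) := by
      intro u hu i hi hiu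
      rw [map_sum]
      exact Finset.sum_pos' (fun j _ => hv j i hi) ⟨i, hi, hvmax i u hu hiu⟩
    refine ⟨∑ j ∈ S, v j, fun i hi => ?_, ?_, hmax⟩
    · rw [map_sum]
      exact Finset.sum_nonneg fun j _ => hv j i hi
    · obtain ⟨i, hi, hiw⟩ := hpos
      exact ⟨i, hi, hmax w hw i hi hiw⟩
  set I := S.filter fun i => 0 < f i w with hIdef
  have hI : I.Nonempty := by
    obtain ⟨i, hi, h⟩ := hpos
    exact ⟨i, by simp [hIdef, hi, h]⟩
  set L : Submodule ℝ E := ⨅ i ∈ S \ I, LinearMap.ker (f i) with hLdef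
  have hmemL : ∀ u, u ∈ L ↔ ∀ i ∈ S, i ∉ I → f i u = 0 := by
    intro u; simp [hLdef, Submodule.mem_iInf]
  have hmemI : ∀ i, i ∈ I ↔ i ∈ S ∧ 0 < f i w := by intro i; simp [hIdef]
  have hwL : w ∈ L := by
    rw [hmemL]
    intro i hi hiI
    rw [hmemI] at hiI
    exact le_antisymm (not_lt.1 fun h => hiI ⟨hi, h⟩) (hw i hi)
  rw [← sum_openEuler_stratum_of_eq_one (fun i => (f i w)⁻¹ • f i) hI L hwL
    fun i hi => by simp [((hmemI i).1 hi).2.ne']]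
  symm
  refine Finset.sum_of_injOn (fun K => K ∪ (S \ I)) ?_ ?_ ?_ ?_
  · intro K hK K' hK' h
    simp only [Finset.coe_powerset, mem_preimage, mem_powerset_iff, Finset.coe_subset] at hK hK'
    have h : K ∪ (S \ I) = K' ∪ (S \ I) := h
    ext i
    have := Finset.ext_iff.1 h i
    have h1 := @hK i
    have h2 := @hK' i
    simp only [Finset.mem_union, Finset.mem_sdiff] at this
    tauto
  · intro K hK
    simp only [Finset.coe_powerset, mem_preimage, mem_powerset_iff, Finset.coe_subset] at hK ⊢
    exact Finset.union_subset (hK.trans (Finset.filter_subset _ _)) Finset.sdiff_subset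
  · intro J hJ hJK
    rw [Finset.mem_powerset] at hJ
    suffices h : coneStratum f S J = ∅ by rw [h, openEuler_empty]
    refine eq_empty_of_forall_notMem fun u hu => hJK ⟨J ∩ I, by simp, ?_⟩
    have hu0 : ∀ i ∈ S, 0 ≤ f i u := fun i hi => by
      by_cases hiJ : i ∈ J
      · exact (hu.1 i hiJ).ge
      · exact (hu.2 i hi hiJ).le
    have hsub : ∀ i ∈ S, i ∉ I → i ∈ J := fun i hi hiI => by
      by_contra hiJ
      exact hiI ((hmemI i).2 ⟨hi, hmax u hu0 i hi (hu.2 i hi hiJ)⟩)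
    ext i
    have h1 := hsub i
    have h2 := @hJ i
    simp only [Finset.mem_union, Finset.mem_inter, Finset.mem_sdiff]
    tauto
  · intro K hK
    rw [Finset.mem_powerset] at hK
    congr 1
    ext u
    simp only [mem_inter_iff, SetLike.mem_coe, hmemL, coneStratum, mem_ofPred_eq,
      Finset.mem_union, Finset.mem_sdiff, LinearMap.smul_apply, smul_eq_mul]
    have hz : ∀ i ∈ I, ((f i w)⁻¹ * f i u = 0 ↔ f i u = 0) := fun i hi => by
      simp [((hmemI i).1 hi).2.ne']
    have hp : ∀ i ∈ I, (0 < (f i w)⁻¹ * f i u ↔ 0 < f i u) := fun i hi =>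
      mul_pos_iff_of_pos_left (inv_pos.2 ((hmemI i).1 hi).2)
    have hIS : ∀ i ∈ I, i ∈ S := fun i hi => ((hmemI i).1 hi).1
    constructor
    · rintro ⟨h1, h2, h3⟩
      refine ⟨?_, ?_⟩
      · rintro i (hi | ⟨hi, hiI⟩)
        · exact (hz i (hK hi)).1 (h2 i hi)
        · exact h1 i hi hiI
      · intro i hi hiK
        have hiI : i ∈ I := by tauto
        exact (hp i hiI).1 (h3 i hiI (by tauto))
    · rintro ⟨h1, h2⟩
      exact ⟨fun i hi hiI => h1 i (Or.inr ⟨hi, hiI⟩),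
        fun i hi => (hz i (hK hi)).2 (h1 i (Or.inl hi)),
        fun i hi hiK => (hp i hi).2 (h2 i (hIS i hi) (by tauto))⟩

end RelativelyOpenCones

section Polytopes

variable {E : Type*} [NormedAddCommGroup E] [InnerProductSpace ℝ E]

lemma inner_eq_of_mem_intrinsicInterior {P : Set E} {x u : E} (hx : x ∈ intrinsicInterior ℝ P)
    (hu : ∀ y ∈ P, ⟪y, u⟫ ≤ ⟪x, u⟫) : ∀ y ∈ P, ⟪y, u⟫ = ⟪x, u⟫ := by
  intro y hy
  obtain ⟨x', hx', rfl⟩ := mem_intrinsicInterior.1 hx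
  let φ : ℝ → affineSpan ℝ P := fun t =>
    ⟨AffineMap.lineMap (x' : E) y t, AffineMap.lineMap_mem t x'.2 (subset_affineSpan ℝ P hy)⟩
  have hφ : Continuous φ := Continuous.subtype_mk AffineMap.lineMap_continuous _
  have hφ0 : φ 0 = x' := by ext; simp [φ]
  have hev : ∀ᶠ t : ℝ in nhds 0, AffineMap.lineMap (x' : E) y t ∈ P := by
    rw [← hφ0] at hx'
    exact hφ.continuousAt.eventually_mem (mem_interior_iff_mem_nhds.1 hx')
  obtain ⟨ε, hε, h⟩ := Metric.eventually_nhds_iff.1 hev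
  have hmem : AffineMap.lineMap (x' : E) y (-(ε / 2)) ∈ P := by
    apply h
    simp [abs_of_pos hε, hε]
  have h1 := hu _ hmem
  rw [AffineMap.lineMap_apply_module', inner_add_left, inner_smul_left, inner_sub_left] at h1
  simp only [conj_trivial] at h1
  have h2 := hu y hy
  nlinarith

lemma exists_nontrivial_support [FiniteDimensional ℝ E] {P : Set E} (hP : Convex ℝ P) {x : E}
    (hx : x ∈ P) (hx' : x ∉ intrinsicInterior ℝ P) :
    ∃ w, (∀ y ∈ P, ⟪y, w⟫ ≤ ⟪x, w⟫) ∧ ∃ y ∈ P, ⟪y, w⟫ < ⟪x, w⟫ := by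
  set D := (affineSpan ℝ P).direction
  have hxs : x ∈ affineSpan ℝ P := subset_affineSpan ℝ P hx
  let φ : D → affineSpan ℝ P :=
    fun v => ⟨(v : E) +ᵥ x, AffineSubspace.vadd_mem_of_mem_direction v.2 hxs⟩
  let ψ : affineSpan ℝ P → D := fun y => ⟨(y : E) -ᵥ x, AffineSubspace.vsub_mem_direction y.2 hxs⟩
  have hφ : Continuous φ := by
    refine Continuous.subtype_mk ?_ _
    simp only [vadd_eq_add]; fun_prop
  have hψ : Continuous ψ := by
    refine Continuous.subtype_mk ?_ _
    simp only [vsub_eq_sub]; fun_prop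
  have hφψ : ∀ y, φ (ψ y) = y := fun y => by ext; simp [φ, ψ]
  set K : Set D := {v | (v : E) + x ∈ P}
  have hKφ : K = φ ⁻¹' ((↑) ⁻¹' P) := rfl
  have hK : Convex ℝ K := by
    intro a ha b hb s t hs ht hst
    have h := hP ha hb hs ht hst
    have he : s • ((a : E) + x) + t • ((b : E) + x) = (s • a + t • b : D) + x := by
      have : x = (s + t) • x := by rw [hst, one_smul]
      conv_rhs => rw [this]
      push_cast
      module
    rw [he] at h
    exact h
  have hKint : (interior K).Nonempty := by
    obtain ⟨z, hz⟩ := Set.Nonempty.intrinsicInterior hP ⟨x, hx⟩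
    obtain ⟨z', hz', -⟩ := mem_intrinsicInterior.1 hz
    refine ⟨ψ z', mem_interior_iff_mem_nhds.2 ?_⟩
    rw [hKφ]
    apply hφ.continuousAt.preimage_mem_nhds
    rw [hφψ]
    exact mem_interior_iff_mem_nhds.1 hz'
  have h0 : (0 : D) ∉ interior K := by
    intro h0
    refine hx' (mem_intrinsicInterior.2 ⟨⟨x, hxs⟩, mem_interior_iff_mem_nhds.2 ?_, rfl⟩)
    have hψ0 : ψ ⟨x, hxs⟩ = 0 := by ext; simp [ψ]
    have := hψ.continuousAt.preimage_mem_nhds (x := ⟨x, hxs⟩) (t := K)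
      (by rw [hψ0]; exact mem_interior_iff_mem_nhds.1 h0)
    convert this using 1
    ext y
    simp [K, ψ]
  obtain ⟨f, r, hf0, hfK, hfr⟩ := geometric_hahn_banach_of_nonempty_interior hK
    (convex_singleton (0 : D)) (disjoint_singleton_right.2 h0) hKint (singleton_nonempty _)
  have hr : r ≤ 0 := by simpa using hfr 0 rfl
  set w : D := (InnerProductSpace.toDual ℝ D).symm f with hw
  have hfw : ∀ v : D, f v = ⟪(v : E), (w : E)⟫ := by
    intro v
    rw [real_inner_comm, ← Submodule.coe_inner, hw, InnerProductSpace.toDual_symm_apply]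
  have hle : ∀ y ∈ P, ⟪y, (w : E)⟫ ≤ ⟪x, (w : E)⟫ := by
    intro y hy
    have h := hfK (ψ ⟨y, subset_affineSpan ℝ P hy⟩) (by simpa [K, ψ] using hy)
    rw [hfw] at h
    simp only [ψ, vsub_eq_sub, inner_sub_left] at h
    linarith
  refine ⟨w, hle, ?_⟩
  by_contra! hcon
  apply hf0
  obtain ⟨k, hk⟩ := hKint
  ext v
  obtain ⟨ε, hε, h1, -⟩ := exists_pos_add_smul_mem isOpen_interior hk v
  have hz : ∀ k ∈ interior K, f k = 0 := by
    intro k hk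
    have hkP : k ∈ K := interior_subset hk
    have := le_antisymm (hle _ hkP) (hcon _ hkP)
    rw [inner_add_left] at this
    rw [hfw]
    linarith
  have h2 := hz _ h1
  rw [map_add, hz k hk, map_smul, zero_add, smul_eq_mul] at h2
  simpa [hε.ne'] using h2

lemma inner_eq_inter_convexHull {S : Finset E} {u : E} {r : ℝ} (h : ∀ s ∈ S, ⟪s, u⟫ ≤ r) :
    {y ∈ convexHull ℝ (S : Set E) | ⟪y, u⟫ = r} =
      convexHull ℝ ((S.filter fun s => ⟪s, u⟫ = r : Finset E) : Set E) := by
  apply Subset.antisymm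
  · rintro y ⟨hy, hyr⟩
    obtain ⟨c, hc0, hc1, rfl⟩ := Finset.mem_convexHull'.1 hy
    have hsum : ∑ s ∈ S, c s * (r - ⟪s, u⟫) = 0 := by
      simp only [mul_sub, Finset.sum_sub_distrib, ← Finset.sum_mul, hc1]
      rw [sum_inner] at hyr
      simp only [inner_smul_left, conj_trivial] at hyr
      rw [hyr]; ring
    rw [Finset.sum_eq_zero_iff_of_nonneg
      fun s hs => mul_nonneg (hc0 s hs) (sub_nonneg.2 (h s hs))] at hsum
    have hne : ∀ s ∈ S, c s ≠ 0 → ⟪s, u⟫ = r := fun s hs hcs =>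
      (sub_eq_zero.1 ((mul_eq_zero.1 (hsum s hs)).resolve_left hcs)).symm
    refine Finset.mem_convexHull'.2 ⟨c, fun s hs => hc0 s (Finset.mem_filter.1 hs).1, ?_, ?_⟩
    · rw [Finset.sum_filter_of_ne hne, hc1]
    · exact Finset.sum_filter_of_ne fun s hs hcs => hne s hs fun h0 => hcs (by simp [h0])
  · apply convexHull_min
    · intro s hs
      obtain ⟨hs, hsr⟩ := Finset.mem_filter.1 hs
      exact ⟨subset_convexHull ℝ _ hs, hsr⟩
    · refine (convex_convexHull ℝ _).inter ?_
      have : {y : E | ⟪y, u⟫ = r} = {y : E | innerₗ E u y = r} := by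
        ext y; simp [real_inner_comm]
      change Convex ℝ {y : E | ⟪y, u⟫ = r}
      rw [this]
      exact convex_hyperplane (innerₗ E u).isLinear r

/-- The stratum of the normal cone of `convexHull ℝ S` at `x` whose members are maximal over `S`
exactly along `J`. -/
def normalStratum (S : Finset E) (x : E) (J : Finset E) : Set E :=
  coneStratum (fun s => innerₗ E (x - s)) S J

lemma mem_normalStratum {S J : Finset E} {x u : E} : u ∈ normalStratum S x J ↔
    (∀ s ∈ J, ⟪s, u⟫ = ⟪x, u⟫) ∧ ∀ s ∈ S, s ∉ J → ⟪s, u⟫ < ⟪x, u⟫ := by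
  simp [normalStratum, coneStratum, sub_eq_zero, eq_comm]

lemma le_of_mem_normalStratum {S J : Finset E} {x u : E} (hu : u ∈ normalStratum S x J) :
    ∀ s ∈ S, ⟪s, u⟫ ≤ ⟪x, u⟫ := by
  rw [mem_normalStratum] at hu
  intro s hs
  by_cases hsJ : s ∈ J
  · exact (hu.1 s hsJ).le
  · exact (hu.2 s hs hsJ).le

lemma filter_eq_of_mem_normalStratum {S J : Finset E} (hJ : J ⊆ S) {x u : E}
    (hu : u ∈ normalStratum S x J) : S.filter (fun s => ⟪s, u⟫ = ⟪x, u⟫) = J := by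
  rw [mem_normalStratum] at hu
  ext s
  rw [Finset.mem_filter]
  constructor
  · rintro ⟨hs, h⟩
    by_contra hsJ
    exact (hu.2 s hs hsJ).ne h
  · exact fun hs => ⟨hJ hs, hu.1 s hs⟩

lemma convexHull_eq_of_mem_normalStratum {S J : Finset E} (hJ : J ⊆ S) {x u : E}
    (hu : u ∈ normalStratum S x J) :
    convexHull ℝ (J : Set E) = {y ∈ convexHull ℝ (S : Set E) | ⟪y, u⟫ = ⟪x, u⟫} := by
  rw [inner_eq_inter_convexHull (le_of_mem_normalStratum hu),
    filter_eq_of_mem_normalStratum hJ hu]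

lemma mem_normalStratum_filter {S : Finset E} {x u : E} (hu : ∀ s ∈ S, ⟪s, u⟫ ≤ ⟪x, u⟫) :
    u ∈ normalStratum S x (S.filter fun s => ⟪s, u⟫ = ⟪x, u⟫) := by
  rw [mem_normalStratum]
  refine ⟨fun s hs => (Finset.mem_filter.1 hs).2, fun s hs hsJ => lt_of_le_of_ne (hu s hs) ?_⟩
  exact fun h => hsJ (Finset.mem_filter.2 ⟨hs, h⟩)

lemma span_normalStratum [FiniteDimensional ℝ E] {S J : Finset E} {x : E}
    (hx : x ∈ convexHull ℝ (J : Set E)) (hne : (normalStratum S x J).Nonempty) :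
    Submodule.span ℝ (normalStratum S x J) = (affineSpan ℝ (J : Set E)).directionᗮ := by
  have hO : IsOpen {u : E | ∀ s ∈ S \ J, 0 < innerₗ E (x - s) u} := by
    simp only [ofPred_forall]
    exact isOpen_biInter_finset fun s _ => isOpen_linear_pos (innerₗ E (x - s))
  have hs : normalStratum S x J = {u : E | ∀ s ∈ S \ J, 0 < innerₗ E (x - s) u} ∩
      ((affineSpan ℝ (J : Set E)).directionᗮ : Submodule ℝ E) := by
    ext u
    have hu : (∀ s ∈ J, innerₗ E (x - s) u = 0) ↔ u ∈ (affineSpan ℝ (J : Set E)).directionᗮ := by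
      constructor
      · intro h
        have hle : (affineSpan ℝ (J : Set E)).direction ≤ (ℝ ∙ u)ᗮ := by
          rw [direction_affineSpan, vectorSpan_def, Submodule.span_le]
          rintro _ ⟨s, hs, t, ht, rfl⟩
          have h1 := h s hs
          have h2 := h t ht
          simp only [innerₗ_apply_apply, inner_sub_left] at h1 h2
          simp only [SetLike.mem_coe, Submodule.mem_orthogonal_singleton_iff_inner_left,
            vsub_eq_sub, inner_sub_left]
          linarith
        rw [Submodule.mem_orthogonal]
        intro v hv
        exact Submodule.mem_orthogonal_singleton_iff_inner_left.1 (hle hv)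
      · intro h s hs
        exact (Submodule.mem_orthogonal _ _).1 h _ (AffineSubspace.vsub_mem_direction
          (convexHull_subset_affineSpan _ hx) (subset_affineSpan ℝ _ hs))
    rw [mem_inter_iff, SetLike.mem_coe, ← hu]
    simp only [normalStratum, coneStratum, mem_ofPred_eq, Finset.mem_sdiff]
    tauto
  rw [hs] at hne ⊢
  exact span_open_inter hO _ hne

end Polytopes

lemma neg_one_pow_polyDim {S J : Finset (Euc n)} {x : Euc n}
    (hx : x ∈ convexHull ℝ (J : Set (Euc n))) (hne : (normalStratum S x J).Nonempty) :
    (-1 : ℝ) ^ n * openEuler (normalStratum S x J) =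
      (-1) ^ polyDim (convexHull ℝ (J : Set (Euc n))) := by
  rw [openEuler, if_pos hne, span_normalStratum hx hne, polyDim, affineSpan_convexHull]
  have h := (affineSpan ℝ (J : Set (Euc n))).direction.finrank_add_finrank_orthogonal
  rw [finrank_euclideanSpace_fin] at h
  nth_rewrite 1 [← h]
  rw [pow_add, mul_assoc, ← mul_pow]
  simp

lemma sum_faces_eq_sum_normalStratum {S : Finset (Euc n)} {x : Euc n}
    (hx : x ∈ convexHull ℝ (S : Set (Euc n)))
    (hfin : {Q | IsPolyFace (convexHull ℝ (S : Set (Euc n))) Q ∧ Q.Nonempty}.Finite) :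
    ∑ Q ∈ hfin.toFinset, (-1 : ℝ) ^ polyDim Q * Q.indicator (fun _ => (1 : ℝ)) x =
      (-1) ^ n * ∑ J ∈ S.powerset, openEuler (normalStratum S x J) := by
  have hne : ∀ J ∈ S.powerset, openEuler (normalStratum S x J) ≠ 0 →
      (normalStratum S x J).Nonempty := by
    intro J _ h
    by_contra hemp
    exact h (by rw [openEuler, if_neg hemp])
  have hxJ : ∀ J ⊆ S, (normalStratum S x J).Nonempty → x ∈ convexHull ℝ (J : Set (Euc n)) := by
    rintro J hJ ⟨u, hu⟩
    rw [convexHull_eq_of_mem_normalStratum hJ hu]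
    exact ⟨hx, rfl⟩
  have hJmem : ∀ J ⊆ S, (normalStratum S x J).Nonempty →
      ∀ s, s ∈ J ↔ s ∈ S ∧ s ∈ convexHull ℝ (J : Set (Euc n)) := by
    rintro J hJ ⟨u, hu⟩ s
    refine ⟨fun hs => ⟨hJ hs, subset_convexHull ℝ _ hs⟩, fun ⟨hs, hsJ⟩ => ?_⟩
    rw [convexHull_eq_of_mem_normalStratum hJ hu] at hsJ
    rw [← filter_eq_of_mem_normalStratum hJ hu]
    exact Finset.mem_filter.2 ⟨hs, hsJ.2⟩
  rw [← Finset.sum_filter_of_ne hne, Finset.mul_sum]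
  symm
  refine Finset.sum_of_injOn (fun J : Finset (Euc n) => convexHull ℝ (J : Set (Euc n)))
    ?_ ?_ ?_ ?_
  · intro J hJ J' hJ' h
    obtain ⟨hJ, hJne⟩ := Finset.mem_filter.1 hJ
    obtain ⟨hJ', hJne'⟩ := Finset.mem_filter.1 hJ'
    have h : convexHull ℝ (J : Set (Euc n)) = convexHull ℝ (J' : Set (Euc n)) := h
    ext s
    rw [hJmem J (Finset.mem_powerset.1 hJ) hJne, hJmem J' (Finset.mem_powerset.1 hJ') hJne', h]
  · intro J hJ
    obtain ⟨hJ, hJne⟩ := Finset.mem_filter.1 hJ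
    rw [Finset.mem_powerset] at hJ
    rw [Finset.mem_coe, Finite.mem_toFinset]
    refine ⟨?_, x, hxJ J hJ hJne⟩
    obtain ⟨u, hu⟩ := hJne
    have heq := convexHull_eq_of_mem_normalStratum hJ hu
    by_cases hu0 : u = 0
    · left
      simp [heq, hu0]
    · refine Or.inr ⟨u, hu0, ⟪x, u⟫, fun y hy => ?_, heq⟩
      have hconv : Convex ℝ {y : Euc n | innerₗ (Euc n) u y ≤ ⟪x, u⟫} :=
        convex_halfSpace_le (innerₗ (Euc n) u).isLinear _
      have := convexHull_min (fun s hs => by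
        simpa [real_inner_comm] using le_of_mem_normalStratum hu s hs) hconv hy
      simpa [real_inner_comm] using this
  · intro Q hQ himg
    rw [Finite.mem_toFinset] at hQ
    suffices hxQ : x ∉ Q by simp [hxQ]
    intro hxQ
    apply himg
    obtain ⟨u, hu, rfl⟩ : ∃ u, (∀ s ∈ S, ⟪s, u⟫ ≤ ⟪x, u⟫) ∧
        Q = {y ∈ convexHull ℝ (S : Set (Euc n)) | ⟪y, u⟫ = ⟪x, u⟫} := by
      obtain rfl | ⟨u, -, r, hr, rfl⟩ := hQ.1
      · exact ⟨0, by simp⟩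
      · rw [← hxQ.2] at hr ⊢
        exact ⟨u, fun s hs => hr s (subset_convexHull ℝ _ hs), rfl⟩
    refine ⟨S.filter fun s => ⟪s, u⟫ = ⟪x, u⟫, ?_, (inner_eq_inter_convexHull hu).symm⟩
    rw [Finset.mem_coe, Finset.mem_filter, Finset.mem_powerset]
    exact ⟨Finset.filter_subset _ _, u, mem_normalStratum_filter hu⟩
  · intro J hJ
    obtain ⟨hJ, hJne⟩ := Finset.mem_filter.1 hJ
    have hxm := hxJ J (Finset.mem_powerset.1 hJ) hJne
    rw [neg_one_pow_polyDim hxm hJne, indicator_of_mem hxm, mul_one]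

/-- For a polytope `P ⊂ ℝⁿ`, `Σ_{Q ⪯ P} (−1)^{dim Q} 𝟙_Q = (−1)^{dim P} 𝟙_{relint P}`,
the sum running over all nonempty faces of `P` (including `P` itself). -/
theorem alternating_sum_faces {n : ℕ} (P : Set (Euc n)) (hP : IsPolytope P)
    (hfin : {Q | IsPolyFace P Q ∧ Q.Nonempty}.Finite) :
    ∀ x : Euc n,
      (∑ Q ∈ hfin.toFinset, (-1 : ℝ) ^ polyDim Q * Q.indicator (fun _ => (1 : ℝ)) x)
        = (-1 : ℝ) ^ polyDim P *
            (intrinsicInterior ℝ P).indicator (fun _ => (1 : ℝ)) x := by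
  intro x
  obtain ⟨S, rfl⟩ := hP
  by_cases hx : x ∈ convexHull ℝ (S : Set (Euc n))
  swap
  · rw [indicator_of_notMem fun h => hx (intrinsicInterior_subset h), mul_zero]
    refine Finset.sum_eq_zero fun Q hQ => ?_
    rw [Finite.mem_toFinset] at hQ
    have hxQ : x ∉ Q := by
      obtain rfl | ⟨u, -, r, -, rfl⟩ := hQ.1
      · exact hx
      · exact fun h => hx h.1
    rw [indicator_of_notMem hxQ, mul_zero]
  by_cases hxi : x ∈ intrinsicInterior ℝ (convexHull ℝ (S : Set (Euc n)))
  · rw [indicator_of_mem hxi, Finset.sum_eq_single (convexHull ℝ (S : Set (Euc n))),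
      indicator_of_mem hx]
    · intro Q hQ hne
      rw [Finite.mem_toFinset] at hQ
      obtain rfl | ⟨u, -, r, hr, rfl⟩ := hQ.1
      · exact absurd rfl hne
      rw [indicator_of_notMem, mul_zero]
      rintro ⟨-, rfl⟩
      exact hne (sep_eq_self_iff_mem_true.2 (inner_eq_of_mem_intrinsicInterior hxi hr))
    · intro h
      exact (h (by rw [Finite.mem_toFinset]; exact ⟨Or.inl rfl, x, hx⟩)).elim
  · rw [indicator_of_notMem hxi, mul_zero, sum_faces_eq_sum_normalStratum hx]
    obtain ⟨w, hw, y, hy, hyw⟩ := exists_nontrivial_support (convex_convexHull ℝ _) hx hxi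
    have hwS : ∀ s ∈ S, ⟪s, w⟫ ≤ ⟪x, w⟫ := fun s hs => hw s (subset_convexHull ℝ _ hs)
    have hpos : ∃ s ∈ S, ⟪s, w⟫ < ⟪x, w⟫ := by
      by_contra! hcon
      have heq := inner_eq_inter_convexHull hwS
      rw [Finset.filter_true_of_mem fun s hs => le_antisymm (hwS s hs) (hcon s hs)] at heq
      rw [← heq] at hy
      exact hyw.ne hy.2
    unfold normalStratum
    rw [sum_openEuler_coneStratum (w := w), mul_zero]
    · simpa [inner_sub_left] using hwS
    · simpa [inner_sub_left] using hpos
end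
end

section
/- Nearest face fan of a simplicial cone: Let σ ⊂ ℝⁿ be a full-dimensional simplicial cone with edge vectors w₁, …, wₙ (a basis of ℝⁿ) and let b₁, …, bₙ be the dual basis (⟨w_i, b_j⟩ = δ_{ij}). For J ⊆ {1, …, n}, let τ_J = Cone(w_j : j ∈ J) and let V_σ^{τ_J} be the set of x ∈ ℝⁿ whose unique nearest point in σ lies in the relative interior of τ_J. Then the closure of V_σ^{τ_J} equals the convex cone generated by {w_j : j ∈ J} ∪ {−b_i : i ∉ J}; in particular, these cones, for J ranging over subsets of {1,…,n}, are the maximal cones of a complete fan in ℝⁿ. -/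
open Set MeasureTheory
open scoped RealInnerProductSpace BigOperators Classical Pointwise

noncomputable section

variable {n : ℕ}

/-- The convex cone generated by the vectors `w 0, …, w (d−1)`. -/
def coneOfFam {d : ℕ} (w : Fin d → Euc n) : Set (Euc n) :=
  {x | ∃ a : Fin d → ℝ, (∀ i, 0 ≤ a i) ∧ x = ∑ i, a i • w i}

/-- `τ` is a face of the cone `σ`: either `τ = σ`, or `τ` is the intersection of `σ` with a
supporting hyperplane (through the origin). -/
def IsConeFace (σ τ : Set (Euc n)) : Prop :=
  τ = σ ∨ ∃ u : Euc n, (∀ x ∈ σ, 0 ≤ ⟪x, u⟫) ∧ τ = {x ∈ σ | ⟪x, u⟫ = 0}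

/-- The face `τ_J = Cone(w_j : j ∈ J)`. -/
def tauJ (w : Fin n → Euc n) (J : Finset (Fin n)) : Set (Euc n) :=
  {x | ∃ lam : Fin n → ℝ, (∀ j, 0 ≤ lam j) ∧ x = ∑ j ∈ J, lam j • w j}

/-- `V_σ^{τ_J}`: points whose (unique) nearest point in `σ = Cone(w₁,…,wₙ)` lies in the
relative interior of the face `τ_J`. -/
def nearFaceCone (w : Fin n → Euc n) (J : Finset (Fin n)) : Set (Euc n) :=
  {x | ∃ q ∈ intrinsicInterior ℝ (tauJ w J), q ∈ coneOfFam w ∧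
        ∀ p ∈ coneOfFam w, dist x q ≤ dist x p}

/-- The cone generated by `{w_j : j ∈ J} ∪ {−b_i : i ∉ J}`. -/
def genConeJ (w b : Fin n → Euc n) (J : Finset (Fin n)) : Set (Euc n) :=
  {x | ∃ lam mu : Fin n → ℝ, (∀ i, 0 ≤ lam i) ∧ (∀ i, 0 ≤ mu i) ∧
        x = ∑ j ∈ J, lam j • w j + ∑ i ∈ Jᶜ, mu i • (-(b i))}

open scoped Topology

/-- A spanning family expands every vector with the inner products against its dual family. -/
theorem eq_sum_inner_smul_of_dual {w b : Fin n → Euc n}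
    (hspan : Submodule.span ℝ (Set.range w) = ⊤)
    (hdual : ∀ i j, ⟪w i, b j⟫ = if i = j then 1 else 0) (x : Euc n) :
    x = ∑ i, ⟪x, b i⟫ • w i := by
  have hx : x ∈ Submodule.span ℝ (Set.range w) := hspan ▸ Submodule.mem_top
  obtain ⟨c, rfl⟩ := (Submodule.mem_span_range_iff_exists_fun ℝ).1 hx
  simp [sum_inner, real_inner_smul_left, hdual]

/-- The inner product of two vectors in terms of their coordinates in dual bases. -/
theorem inner_eq_sum_of_dual {w b : Fin n → Euc n}
    (hspan : Submodule.span ℝ (Set.range w) = ⊤)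
    (hdual : ∀ i j, ⟪w i, b j⟫ = if i = j then 1 else 0) (y p : Euc n) :
    ⟪y, p⟫ = ∑ i, ⟪p, b i⟫ * ⟪y, w i⟫ := by
  conv_lhs => rw [eq_sum_inner_smul_of_dual hspan hdual p]
  simp [inner_sum, real_inner_smul_right]

/-- Every vector is expanded in the dual family `b` with the inner products against `w`. -/
theorem eq_sum_inner_smul_dual {w b : Fin n → Euc n}
    (hspan : Submodule.span ℝ (Set.range w) = ⊤)
    (hdual : ∀ i j, ⟪w i, b j⟫ = if i = j then 1 else 0) (y : Euc n) :
    y = ∑ i, ⟪y, w i⟫ • b i := by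
  refine ext_inner_right ℝ fun p => ?_
  rw [inner_eq_sum_of_dual hspan hdual y p, sum_inner]
  refine Finset.sum_congr rfl fun i _ => ?_
  rw [real_inner_smul_left, real_inner_comm p, mul_comm]

theorem mem_coneOfFam_iff {w b : Fin n → Euc n}
    (hspan : Submodule.span ℝ (Set.range w) = ⊤)
    (hdual : ∀ i j, ⟪w i, b j⟫ = if i = j then 1 else 0) {x : Euc n} :
    x ∈ coneOfFam w ↔ ∀ i, 0 ≤ ⟪x, b i⟫ := by
  constructor
  · rintro ⟨a, ha, rfl⟩ i
    simpa [sum_inner, real_inner_smul_left, hdual] using ha i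
  · exact fun h => ⟨_, h, eq_sum_inner_smul_of_dual hspan hdual x⟩

theorem mem_tauJ_iff {w b : Fin n → Euc n}
    (hspan : Submodule.span ℝ (Set.range w) = ⊤)
    (hdual : ∀ i j, ⟪w i, b j⟫ = if i = j then 1 else 0) {J : Finset (Fin n)} {x : Euc n} :
    x ∈ tauJ w J ↔ (∀ i, 0 ≤ ⟪x, b i⟫) ∧ ∀ i ∉ J, ⟪x, b i⟫ = 0 := by
  constructor
  · rintro ⟨a, ha, rfl⟩
    simp only [sum_inner, real_inner_smul_left, hdual, mul_ite, mul_one, mul_zero,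
      Finset.sum_ite_eq']
    exact ⟨fun i => by split_ifs <;> simp [ha], fun i hi => by simp [hi]⟩
  · rintro ⟨h, h0⟩
    refine ⟨_, h, ?_⟩
    conv_lhs => rw [eq_sum_inner_smul_of_dual hspan hdual x]
    exact (Finset.sum_subset (Finset.subset_univ J) fun i _ hi => by simp [h0 i hi]).symm

theorem mem_intrinsicInterior_tauJ_iff {w b : Fin n → Euc n}
    (hspan : Submodule.span ℝ (Set.range w) = ⊤)
    (hdual : ∀ i j, ⟪w i, b j⟫ = if i = j then 1 else 0) {J : Finset (Fin n)} {q : Euc n} :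
    q ∈ intrinsicInterior ℝ (tauJ w J) ↔ (∀ i ∈ J, 0 < ⟪q, b i⟫) ∧ ∀ i ∉ J, ⟪q, b i⟫ = 0 := by
  constructor
  · intro hq
    have hqτ := intrinsicInterior_subset hq
    obtain ⟨hq0, hqJ⟩ := (mem_tauJ_iff hspan hdual).1 hqτ
    refine ⟨fun j hj => ?_, hqJ⟩
    obtain ⟨y, hy, rfl⟩ := mem_intrinsicInterior.1 hq
    have hqw : (y : Euc n) + w j ∈ tauJ w J := by
      rw [mem_tauJ_iff hspan hdual]
      refine ⟨fun i => ?_, fun i hi => ?_⟩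
      · rw [inner_add_left, hdual]
        have := hq0 i
        split_ifs <;> linarith
      · rw [inner_add_left, hdual, hqJ i hi, if_neg (by rintro rfl; exact hi hj), add_zero]
    have hmem : ∀ t : ℝ, (y : Euc n) + t • w j ∈ affineSpan ℝ (tauJ w J) := fun t => by
      have := AffineMap.lineMap_mem t y.2 (subset_affineSpan ℝ _ hqw)
      rwa [AffineMap.lineMap_apply, vsub_eq_sub, add_sub_cancel_left, vadd_eq_add,
        add_comm] at this
    let γ : ℝ → affineSpan ℝ (tauJ w J) := fun t => ⟨y + t • w j, hmem t⟩
    have hγ : Continuous γ := by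
      refine Continuous.subtype_mk ?_ _
      fun_prop
    have hγ0 : γ 0 = y := Subtype.ext (by simp [γ])
    have hev : ∀ᶠ t in 𝓝 (0 : ℝ), γ t ∈ ((↑) ⁻¹' tauJ w J : Set (affineSpan ℝ (tauJ w J))) :=
      hγ.continuousAt.eventually_mem (by rw [hγ0]; exact mem_interior_iff_mem_nhds.1 hy)
    obtain ⟨ε, hε, hball⟩ := Metric.eventually_nhds_iff.1 hev
    have ht := @hball (-(ε / 2)) (by simp [abs_of_pos hε, hε])
    have := ((mem_tauJ_iff hspan hdual).1 ht).1 j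
    simp only [γ, inner_add_left, real_inner_smul_left, hdual, if_true] at this
    linarith
  · rintro ⟨hpos, h0⟩
    have hq0 : ∀ i, 0 ≤ ⟪q, b i⟫ := fun i => by
      by_cases hi : i ∈ J
      exacts [(hpos i hi).le, (h0 i hi).ge]
    have hqτ : q ∈ tauJ w J := (mem_tauJ_iff hspan hdual).2 ⟨hq0, h0⟩
    let L : Submodule ℝ (Euc n) := ⨅ i ∈ (Jᶜ : Finset (Fin n)), (ℝ ∙ b i)ᗮ
    have hL : ∀ {x}, x ∈ L ↔ ∀ i ∉ J, ⟪x, b i⟫ = 0 := by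
      intro x
      simp [L, Submodule.mem_iInf, Submodule.mem_orthogonal_singleton_iff_inner_left]
    have hle : affineSpan ℝ (tauJ w J) ≤ L.toAffineSubspace :=
      affineSpan_le.2 fun x hx => hL.2 ((mem_tauJ_iff hspan hdual).1 hx).2
    refine mem_intrinsicInterior.2 ⟨⟨q, subset_affineSpan ℝ _ hqτ⟩, ?_, rfl⟩
    rw [mem_interior_iff_mem_nhds]
    have hU : ∀ᶠ y : affineSpan ℝ (tauJ w J) in 𝓝 ⟨q, subset_affineSpan ℝ _ hqτ⟩,
        ∀ i ∈ J, 0 < ⟪(y : Euc n), b i⟫ := by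
      rw [Filter.eventually_all_finset]
      intro i hi
      have hc : Continuous fun y : affineSpan ℝ (tauJ w J) => ⟪(y : Euc n), b i⟫ := by fun_prop
      exact hc.continuousAt.eventually_const_lt (hpos i hi)
    filter_upwards [hU] with y hy
    have hyL := hL.1 (hle y.2)
    refine (mem_tauJ_iff hspan hdual).2 ⟨fun i => ?_, hyL⟩
    by_cases hi : i ∈ J
    exacts [(hy i hi).le, (hyL i hi).ge]

/-- `x` decomposes as `q + (x - q)` with `q` in the face `τ_J` and `x - q` in the cone generated
by the `-b i`, `i ∉ J`. -/
structure IsFaceProj (w b : Fin n → Euc n) (J : Finset (Fin n)) (x q : Euc n) : Prop where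
  nonneg : ∀ i, 0 ≤ ⟪q, b i⟫
  eq_zero : ∀ i ∉ J, ⟪q, b i⟫ = 0
  nonpos : ∀ i, ⟪x - q, w i⟫ ≤ 0
  orthogonal : ∀ i ∈ J, ⟪x - q, w i⟫ = 0

theorem isFaceProj_iff {w b : Fin n → Euc n} {J : Finset (Fin n)} {x q : Euc n} :
    IsFaceProj w b J x q ↔ (∀ i, 0 ≤ ⟪q, b i⟫) ∧ (∀ i ∉ J, ⟪q, b i⟫ = 0) ∧
      (∀ i, ⟪x - q, w i⟫ ≤ 0) ∧ ∀ i ∈ J, ⟪x - q, w i⟫ = 0 :=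
  ⟨fun h => ⟨h.1, h.2, h.3, h.4⟩, fun h => ⟨h.1, h.2.1, h.2.2.1, h.2.2.2⟩⟩

theorem mem_genConeJ_iff {w b : Fin n → Euc n}
    (hspan : Submodule.span ℝ (Set.range w) = ⊤)
    (hdual : ∀ i j, ⟪w i, b j⟫ = if i = j then 1 else 0) {J : Finset (Fin n)} {x : Euc n} :
    x ∈ genConeJ w b J ↔ ∃ q, IsFaceProj w b J x q := by
  constructor
  · rintro ⟨a, m, ha, hm, rfl⟩
    obtain ⟨h1, h2⟩ := (mem_tauJ_iff hspan hdual (J := J)).1 ⟨a, ha, rfl⟩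
    have hw : ∀ i, ⟪∑ k ∈ Jᶜ, m k • (-(b k)), w i⟫ = if i ∈ J then 0 else -m i := fun i => by
      rw [real_inner_comm]
      simp only [inner_sum, real_inner_smul_right, inner_neg_right, hdual]
      simp
      split_ifs <;> simp
    refine ⟨_, h1, h2, fun i => ?_, fun i hi => ?_⟩ <;> rw [add_sub_cancel_left, hw]
    · have := hm i
      split_ifs <;> linarith
    · rw [if_pos hi]
  · rintro ⟨q, hq⟩
    obtain ⟨a, ha, haq⟩ := (mem_tauJ_iff hspan hdual).2 ⟨hq.nonneg, hq.eq_zero⟩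
    refine ⟨a, fun i => -⟪x - q, w i⟫, ha, fun i => by linarith [hq.nonpos i], ?_⟩
    rw [← haq, ← sub_eq_iff_eq_add']
    conv_lhs => rw [eq_sum_inner_smul_dual hspan hdual (x - q)]
    simp only [smul_neg, neg_smul, neg_neg]
    exact (Finset.sum_subset (Finset.subset_univ _) fun i _ hi => by
      rw [hq.orthogonal i (by simpa using hi), zero_smul]).symm

theorem IsFaceProj.inner_sub_nonpos {w b : Fin n → Euc n}
    (hspan : Submodule.span ℝ (Set.range w) = ⊤)
    (hdual : ∀ i j, ⟪w i, b j⟫ = if i = j then 1 else 0) {J : Finset (Fin n)} {x q p : Euc n}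
    (h : IsFaceProj w b J x q) (hp : ∀ i, 0 ≤ ⟪p, b i⟫) : ⟪x - q, p - q⟫ ≤ 0 := by
  rw [inner_eq_sum_of_dual hspan hdual]
  refine Finset.sum_nonpos fun i _ => ?_
  by_cases hi : i ∈ J
  · rw [h.orthogonal i hi, mul_zero]
  · rw [inner_sub_left, h.eq_zero i hi, sub_zero]
    exact mul_nonpos_of_nonneg_of_nonpos (hp i) (h.nonpos i)

theorem IsFaceProj.unique {w b : Fin n → Euc n}
    (hspan : Submodule.span ℝ (Set.range w) = ⊤)
    (hdual : ∀ i j, ⟪w i, b j⟫ = if i = j then 1 else 0) {J₁ J₂ : Finset (Fin n)}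
    {x q₁ q₂ : Euc n} (h₁ : IsFaceProj w b J₁ x q₁) (h₂ : IsFaceProj w b J₂ x q₂) : q₁ = q₂ := by
  have e₁ := h₁.inner_sub_nonpos hspan hdual h₂.nonneg
  have e₂ := h₂.inner_sub_nonpos hspan hdual h₁.nonneg
  have e : ⟪q₁ - q₂, q₁ - q₂⟫ = ⟪x - q₁, q₂ - q₁⟫ + ⟪x - q₂, q₁ - q₂⟫ := by
    rw [← neg_sub q₁ q₂, inner_neg_right, neg_add_eq_sub, ← inner_sub_left, sub_sub_sub_cancel_left]
  exact sub_eq_zero.1 (real_inner_self_nonpos.1 (e ▸ add_nonpos e₁ e₂))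

theorem IsFaceProj.dist_le {w b : Fin n → Euc n}
    (hspan : Submodule.span ℝ (Set.range w) = ⊤)
    (hdual : ∀ i j, ⟪w i, b j⟫ = if i = j then 1 else 0) {J : Finset (Fin n)} {x q p : Euc n}
    (h : IsFaceProj w b J x q) (hp : p ∈ coneOfFam w) : dist x q ≤ dist x p := by
  have e := h.inner_sub_nonpos hspan hdual ((mem_coneOfFam_iff hspan hdual).1 hp)
  rw [dist_eq_norm, dist_eq_norm, ← sub_sub_sub_cancel_right x p q]
  refine le_of_sq_le_sq ?_ (norm_nonneg _)
  rw [norm_sub_sq_real (x - q)]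
  nlinarith [sq_nonneg ‖p - q‖]

/-- First-order optimality of a nearest point along a feasible direction. -/
theorem inner_sub_nonpos_of_dist_le {E : Type*} [NormedAddCommGroup E] [InnerProductSpace ℝ E]
    {x q v : E} {δ : ℝ} (hδ : 0 < δ)
    (h : ∀ t, 0 < t → t ≤ δ → dist x q ≤ dist x (q + t • v)) : ⟪x - q, v⟫ ≤ 0 := by
  by_contra! hlt
  have hv : 0 ≤ ‖v‖ ^ 2 := sq_nonneg _
  set t := min δ (⟪x - q, v⟫ / (‖v‖ ^ 2 + 1))
  have ht0 : 0 < t := lt_min hδ (by positivity)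
  have htle : t * (‖v‖ ^ 2 + 1) ≤ ⟪x - q, v⟫ := (le_div_iff₀ (by positivity)).1 (min_le_right _ _)
  have hd := h t ht0 (min_le_left _ _)
  rw [dist_eq_norm, dist_eq_norm, ← sub_sub] at hd
  have hsq := pow_le_pow_left₀ (norm_nonneg _) hd 2
  rw [norm_sub_sq_real (x - q), real_inner_smul_right, norm_smul, mul_pow, Real.norm_eq_abs,
    sq_abs] at hsq
  nlinarith [mul_le_mul_of_nonneg_left htle ht0.le, mul_pos ht0 hlt]

/-- A nearest point of the cone in the relative interior of `τ_J` gives the decomposition. -/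
theorem isFaceProj_of_dist_le {w b : Fin n → Euc n}
    (hspan : Submodule.span ℝ (Set.range w) = ⊤)
    (hdual : ∀ i j, ⟪w i, b j⟫ = if i = j then 1 else 0) {J : Finset (Fin n)} {x q : Euc n}
    (hpos : ∀ i ∈ J, 0 < ⟪q, b i⟫) (h0 : ∀ i ∉ J, ⟪q, b i⟫ = 0)
    (hmin : ∀ p ∈ coneOfFam w, dist x q ≤ dist x p) : IsFaceProj w b J x q := by
  have hq0 : ∀ i, 0 ≤ ⟪q, b i⟫ := fun i => by
    by_cases hi : i ∈ J
    exacts [(hpos i hi).le, (h0 i hi).ge]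
  have hnp : ∀ i, ⟪x - q, w i⟫ ≤ 0 := fun i => by
    refine inner_sub_nonpos_of_dist_le one_pos fun t ht _ => hmin _ ?_
    refine (mem_coneOfFam_iff hspan hdual).2 fun k => ?_
    rw [inner_add_left, real_inner_smul_left, hdual]
    have := hq0 k
    split_ifs <;> linarith
  refine ⟨hq0, h0, hnp, fun i hi => le_antisymm (hnp i) ?_⟩
  rw [← neg_nonpos, ← inner_neg_right]
  refine inner_sub_nonpos_of_dist_le (hpos i hi) fun t ht hti => hmin _ ?_
  refine (mem_coneOfFam_iff hspan hdual).2 fun k => ?_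
  rw [inner_add_left, real_inner_smul_left, inner_neg_left, hdual]
  have := hq0 k
  split_ifs with hik
  · subst hik
    linarith
  · linarith

theorem mem_nearFaceCone_iff {w b : Fin n → Euc n}
    (hspan : Submodule.span ℝ (Set.range w) = ⊤)
    (hdual : ∀ i j, ⟪w i, b j⟫ = if i = j then 1 else 0) {J : Finset (Fin n)} {x : Euc n} :
    x ∈ nearFaceCone w J ↔ ∃ q, IsFaceProj w b J x q ∧ ∀ i ∈ J, 0 < ⟪q, b i⟫ := by
  constructor
  · rintro ⟨q, hq, -, hmin⟩
    obtain ⟨hpos, h0⟩ := (mem_intrinsicInterior_tauJ_iff hspan hdual).1 hq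
    exact ⟨q, isFaceProj_of_dist_le hspan hdual hpos h0 hmin, hpos⟩
  · rintro ⟨q, hq, hpos⟩
    exact ⟨q, (mem_intrinsicInterior_tauJ_iff hspan hdual).2 ⟨hpos, hq.eq_zero⟩,
      (mem_coneOfFam_iff hspan hdual).2 hq.nonneg, fun p => hq.dist_le hspan hdual⟩

theorem IsFaceProj.eq_starProjection {w b : Fin n → Euc n}
    (hspan : Submodule.span ℝ (Set.range w) = ⊤)
    (hdual : ∀ i j, ⟪w i, b j⟫ = if i = j then 1 else 0) {J : Finset (Fin n)} {x q : Euc n}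
    (h : IsFaceProj w b J x q) : (Submodule.span ℝ (w '' J)).starProjection x = q := by
  refine Submodule.eq_starProjection_of_mem_of_inner_eq_zero ?_ fun v hv => ?_
  · obtain ⟨a, -, rfl⟩ := (mem_tauJ_iff hspan hdual).2 ⟨h.nonneg, h.eq_zero⟩
    exact Submodule.sum_mem _ fun i hi =>
      Submodule.smul_mem _ _ (Submodule.subset_span ⟨i, hi, rfl⟩)
  · induction hv using Submodule.span_induction with
    | mem v hv =>
      obtain ⟨i, hi, rfl⟩ := hv
      exact h.orthogonal i hi
    | zero => exact inner_zero_right _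
    | add u v _ _ hu hv => rw [inner_add_right, hu, hv, add_zero]
    | smul c v _ hv => rw [real_inner_smul_right, hv, mul_zero]

theorem mem_genConeJ_iff_starProjection {w b : Fin n → Euc n}
    (hspan : Submodule.span ℝ (Set.range w) = ⊤)
    (hdual : ∀ i j, ⟪w i, b j⟫ = if i = j then 1 else 0) {J : Finset (Fin n)} {x : Euc n} :
    x ∈ genConeJ w b J ↔ IsFaceProj w b J x ((Submodule.span ℝ (w '' J)).starProjection x) := by
  rw [mem_genConeJ_iff hspan hdual]
  refine ⟨?_, fun h => ⟨_, h⟩⟩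
  rintro ⟨q, hq⟩
  rwa [hq.eq_starProjection hspan hdual]

theorem isClosed_genConeJ {w b : Fin n → Euc n}
    (hspan : Submodule.span ℝ (Set.range w) = ⊤)
    (hdual : ∀ i j, ⟪w i, b j⟫ = if i = j then 1 else 0) (J : Finset (Fin n)) :
    IsClosed (genConeJ w b J) := by
  have : genConeJ w b J = {x | IsFaceProj w b J x
      ((Submodule.span ℝ (w '' J)).starProjection x)} :=
    Set.ext fun x => mem_genConeJ_iff_starProjection hspan hdual
  simp only [this, isFaceProj_iff, Set.ofPred_and, Set.ofPred_forall]
  refine .inter ?_ (.inter ?_ (.inter ?_ ?_))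
  · exact isClosed_iInter fun i => isClosed_le (by fun_prop) (by fun_prop)
  · exact isClosed_iInter fun i => isClosed_iInter fun _ => isClosed_eq (by fun_prop) (by fun_prop)
  · exact isClosed_iInter fun i => isClosed_le (by fun_prop) (by fun_prop)
  · exact isClosed_iInter fun i => isClosed_iInter fun _ => isClosed_eq (by fun_prop) (by fun_prop)

theorem closure_nearFaceCone {w b : Fin n → Euc n}
    (hspan : Submodule.span ℝ (Set.range w) = ⊤)
    (hdual : ∀ i j, ⟪w i, b j⟫ = if i = j then 1 else 0) (J : Finset (Fin n)) :
    closure (nearFaceCone w J) = genConeJ w b J := by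
  refine (closure_minimal (fun x hx => ?_) (isClosed_genConeJ hspan hdual J)).antisymm
    fun x hx => ?_
  · obtain ⟨q, hq, -⟩ := (mem_nearFaceCone_iff hspan hdual).1 hx
    exact (mem_genConeJ_iff hspan hdual).2 ⟨q, hq⟩
  · obtain ⟨q, hq⟩ := (mem_genConeJ_iff hspan hdual).1 hx
    set s := ∑ j ∈ J, w j with hs
    have hsb : ∀ i, ⟪s, b i⟫ = if i ∈ J then 1 else 0 := fun i => by
      simp [hs, sum_inner, hdual]
    have hlim : Filter.Tendsto (fun t : ℝ => x + t • s) (𝓝[>] 0) (𝓝 x) := by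
      have hc : Continuous fun t : ℝ => x + t • s := by fun_prop
      simpa using hc.continuousWithinAt (s := Set.Ioi 0) (x := 0) |>.tendsto
    refine mem_closure_of_tendsto hlim ?_
    filter_upwards [self_mem_nhdsWithin] with t ht
    have ht0 : 0 < t := ht
    refine (mem_nearFaceCone_iff hspan hdual).2 ⟨q + t • s, ⟨fun i => ?_, fun i hi => ?_,
      fun i => ?_, fun i hi => ?_⟩, fun i hi => ?_⟩
    · rw [inner_add_left, real_inner_smul_left, hsb]
      have := hq.nonneg i
      split_ifs <;> linarith
    · rw [inner_add_left, real_inner_smul_left, hsb, if_neg hi, hq.eq_zero i hi, mul_zero, add_zero]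
    · rw [add_sub_add_right_eq_sub]
      exact hq.nonpos i
    · rw [add_sub_add_right_eq_sub]
      exact hq.orthogonal i hi
    · rw [inner_add_left, real_inner_smul_left, hsb, if_pos hi]
      linarith [hq.nonneg i]

theorem iUnion_genConeJ {w b : Fin n → Euc n}
    (hspan : Submodule.span ℝ (Set.range w) = ⊤)
    (hdual : ∀ i j, ⟪w i, b j⟫ = if i = j then 1 else 0) :
    (⋃ J : Finset (Fin n), genConeJ w b J) = univ := by
  refine Set.eq_univ_of_forall fun x => ?_
  have hcl : IsClosed (coneOfFam w) := by
    have : coneOfFam w = {x | ∀ i, 0 ≤ ⟪x, b i⟫} :=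
      Set.ext fun x => mem_coneOfFam_iff hspan hdual
    rw [this, Set.ofPred_forall]
    exact isClosed_iInter fun i => isClosed_le (by fun_prop) (by fun_prop)
  have hne : (coneOfFam w).Nonempty := ⟨0, (mem_coneOfFam_iff hspan hdual).2 (by simp)⟩
  obtain ⟨q, hq, hqx⟩ := hcl.exists_infDist_eq_dist hne x
  have hq0 := (mem_coneOfFam_iff hspan hdual).1 hq
  refine Set.mem_iUnion.2 ⟨Finset.univ.filter fun i => 0 < ⟪q, b i⟫,
    (mem_genConeJ_iff hspan hdual).2 ⟨q, isFaceProj_of_dist_le hspan hdual (fun i hi => ?_)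
      (fun i hi => ?_) fun p hp => hqx ▸ Metric.infDist_le_dist_of_mem hp⟩⟩
  · simpa using hi
  · exact le_antisymm (by simpa using hi) (hq0 i)

theorem isConeFace_genConeJ_inter {w b : Fin n → Euc n}
    (hspan : Submodule.span ℝ (Set.range w) = ⊤)
    (hdual : ∀ i j, ⟪w i, b j⟫ = if i = j then 1 else 0) (J₁ J₂ : Finset (Fin n)) :
    IsConeFace (genConeJ w b J₁) (genConeJ w b J₁ ∩ genConeJ w b J₂) := by
  set P := (Submodule.span ℝ (w '' J₁)).starProjection with hP
  have hPmem : ∀ {x}, x ∈ genConeJ w b J₁ → IsFaceProj w b J₁ x (P x) :=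
    (mem_genConeJ_iff_starProjection hspan hdual).1
  set u := ∑ i ∈ J₁ \ J₂, P (b i) - ∑ i ∈ J₂ \ J₁, (w i - P (w i)) with hu
  have hinner : ∀ x, ⟪x, u⟫ = ∑ i ∈ J₁ \ J₂, ⟪P x, b i⟫ + ∑ i ∈ J₂ \ J₁, -⟪x - P x, w i⟫ := by
    intro x
    simp only [hu, hP, inner_sub_right, inner_sum, inner_sub_left,
      Submodule.inner_starProjection_left_eq_right, Finset.sum_neg_distrib]
    rw [sub_eq_add_neg]
  have hA : ∀ {x}, x ∈ genConeJ w b J₁ → ∀ i ∈ J₁ \ J₂, 0 ≤ ⟪P x, b i⟫ :=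
    fun hx i _ => (hPmem hx).nonneg i
  have hB : ∀ {x}, x ∈ genConeJ w b J₁ → ∀ i ∈ J₂ \ J₁, 0 ≤ -⟪x - P x, w i⟫ :=
    fun hx i _ => neg_nonneg.2 ((hPmem hx).nonpos i)
  refine Or.inr ⟨u, fun x hx => ?_, Set.ext fun x => ⟨?_, ?_⟩⟩
  · rw [hinner]
    exact add_nonneg (Finset.sum_nonneg (hA hx)) (Finset.sum_nonneg (hB hx))
  · rintro ⟨hx₁, hx₂⟩
    refine ⟨hx₁, ?_⟩
    obtain ⟨q, hq⟩ := (mem_genConeJ_iff hspan hdual).1 hx₂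
    obtain rfl := (hPmem hx₁).unique hspan hdual hq
    rw [hinner, Finset.sum_eq_zero fun i hi => hq.eq_zero i (Finset.mem_sdiff.1 hi).2,
      Finset.sum_eq_zero fun i hi => neg_eq_zero.2 (hq.orthogonal i (Finset.mem_sdiff.1 hi).1),
      add_zero]
  · rintro ⟨hx, hxu⟩
    rw [hinner, add_eq_zero_iff_of_nonneg (Finset.sum_nonneg (hA hx)) (Finset.sum_nonneg (hB hx)),
      Finset.sum_eq_zero_iff_of_nonneg (hA hx), Finset.sum_eq_zero_iff_of_nonneg (hB hx)] at hxu
    obtain ⟨h₁, h₂⟩ := hxu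
    have h := hPmem hx
    refine ⟨hx, (mem_genConeJ_iff hspan hdual).2 ⟨P x, h.nonneg, fun i hi => ?_, h.nonpos,
      fun i hi => ?_⟩⟩
    · by_cases hi₁ : i ∈ J₁
      exacts [h₁ i (Finset.mem_sdiff.2 ⟨hi₁, hi⟩), h.eq_zero i hi₁]
    · by_cases hi₁ : i ∈ J₁
      exacts [h.orthogonal i hi₁, neg_eq_zero.1 (h₂ i (Finset.mem_sdiff.2 ⟨hi, hi₁⟩))]

/-- **Nearest face fan of a simplicial cone.** Let `σ = Cone(w₁,…,wₙ)` with `w` a basis of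
`ℝⁿ` and dual basis `b`.  For every `J ⊆ {1,…,n}`, the closure of `V_σ^{τ_J}` is the cone
generated by `{w_j : j ∈ J} ∪ {−b_i : i ∉ J}`; in particular these cones are the maximal
cones of a complete fan: their union is `ℝⁿ` and each pairwise intersection is a face of
each of them. -/
theorem nearest_face_fan {n : ℕ} (w b : Fin n → Euc n)
    (hind : LinearIndependent ℝ w)
    (hspan : Submodule.span ℝ (Set.range w) = ⊤)
    (hdual : ∀ i j, ⟪w i, b j⟫ = if i = j then 1 else 0) :
    (∀ J : Finset (Fin n), closure (nearFaceCone w J) = genConeJ w b J) ∧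
    (⋃ J : Finset (Fin n), genConeJ w b J) = univ ∧
    (∀ J₁ J₂ : Finset (Fin n),
      IsConeFace (genConeJ w b J₁) (genConeJ w b J₁ ∩ genConeJ w b J₂) ∧
      IsConeFace (genConeJ w b J₂) (genConeJ w b J₁ ∩ genConeJ w b J₂)) := by
  refine ⟨closure_nearFaceCone hspan hdual, iUnion_genConeJ hspan hdual, fun J₁ J₂ =>
    ⟨isConeFace_genConeJ_inter hspan hdual J₁ J₂, ?_⟩⟩
  rw [Set.inter_comm]
  exact isConeFace_genConeJ_inter hspan hdual J₂ J₁
end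
end
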